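/- arXiv:math/0608232 — 3 statements merged into one kernel-verified Lean document; each statement's English description precedes it below -/
import Mathlib

section
/- For all integers k ≥ 2 and all integers p with 0 ≤ p ≤ k, the identity F̃_p^k = F̃_p^{k−1} + x_k·F̃_{p−1}^{k−1} − q_{k−1}·x_k·F̃_{p−1}^{k−2} holds in ℤ[q_1, q_2, …, x_1, x_2, …]. -/
open MvPolynomial Finset

noncomputable section

/-- The polynomial ring `ℤ[q_1, q_2, …, x_1, x_2, …]`; the variable `Sum.inl i` is `q_i`
and `Sum.inr i` is `x_i`. -/
abbrev P : Type := MvPolynomial (ℕ ⊕ ℕ) ℤ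

/-- The variable `q_i`. -/
def qv (i : ℕ) : P := X (Sum.inl i)

/-- The variable `x_i`. -/
def xv (i : ℕ) : P := X (Sum.inr i)

/-- The polynomial `F̃_p^k`, defined as `0` unless `0 ≤ p ≤ k`. -/
def Ft (p k : ℤ) : P :=
  if 0 ≤ p ∧ p ≤ k then
    ∑ I ∈ (Finset.Icc 1 k.toNat).powersetCard p.toNat,
      (∏ i ∈ I, xv i) * ∏ i ∈ (I.erase 1).filter (fun i => i - 1 ∉ I), (1 - qv (i - 1))
  else 0

/-- The summand of `F̃_p^k` indexed by `I`. -/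
def weight (I : Finset ℕ) : P :=
  (∏ i ∈ I, xv i) * ∏ i ∈ (I.erase 1).filter (fun i => i - 1 ∉ I), (1 - qv (i - 1))

theorem weight_insert {m : ℕ} {J : Finset ℕ} (hJ : J ⊆ Icc 1 (m + 1)) :
    weight (insert (m + 2) J) =
      xv (m + 2) * weight J - if m + 1 ∈ J then 0 else qv (m + 1) * xv (m + 2) * weight J := by
  have hm : m + 2 ∉ J := fun h => by have := mem_Icc.1 (hJ h); omega
  have hfilter : ((J.erase 1).filter fun i => i - 1 ∉ insert (m + 2) J) =
      (J.erase 1).filter fun i => i - 1 ∉ J := by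
    refine filter_congr fun i hi => ?_
    have := mem_Icc.1 (hJ (mem_of_mem_erase hi))
    simp only [mem_insert, not_or, and_iff_right_iff_imp]
    omega
  have herase : (insert (m + 2) J).erase 1 = insert (m + 2) (J.erase 1) :=
    erase_insert_of_ne (by omega)
  unfold weight
  rw [herase, filter_insert, hfilter, prod_insert hm]
  by_cases h : m + 1 ∈ J
  · simp [h, mul_assoc]
  · rw [if_pos (by simp [h]), prod_insert (by simp [hm]), if_neg h]
    simp only [Nat.add_succ_sub_one]
    ring

theorem Ft_natCast (p k : ℕ) :
    Ft p k = ∑ I ∈ (Icc 1 k).powersetCard p, weight I := by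
  unfold Ft weight
  split_ifs with h
  · simp
  · rw [powersetCard_eq_empty.2 (by simp; omega), sum_empty]

theorem Ft_of_neg {p : ℤ} (hp : p < 0) (k : ℤ) : Ft p k = 0 :=
  if_neg (by omega)

theorem Ft_zero (k : ℕ) : Ft 0 k = 1 := by
  simpa [weight] using Ft_natCast 0 k

theorem filter_notMem_powersetCard_Icc (p m : ℕ) :
    ((Icc 1 (m + 1)).powersetCard p).filter (fun J => m + 1 ∉ J) =
      (Icc 1 m).powersetCard p := by
  ext J
  simp only [mem_filter, mem_powersetCard]
  constructor
  · rintro ⟨⟨hJ, hcard⟩, hm⟩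
    refine ⟨fun i hi => ?_, hcard⟩
    have := mem_Icc.1 (hJ hi)
    have : i ≠ m + 1 := fun h => hm (h ▸ hi)
    exact mem_Icc.2 (by omega)
  · rintro ⟨hJ, hcard⟩
    exact ⟨⟨hJ.trans (Icc_subset_Icc_right (by omega)), hcard⟩,
      fun h => by have := mem_Icc.1 (hJ h); omega⟩

theorem sum_weight_succ (p m : ℕ) :
    ∑ I ∈ (Icc 1 (m + 2)).powersetCard (p + 1), weight I =
      ∑ I ∈ (Icc 1 (m + 1)).powersetCard (p + 1), weight I
        + xv (m + 2) * ∑ I ∈ (Icc 1 (m + 1)).powersetCard p, weight I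
        - qv (m + 1) * xv (m + 2) * ∑ I ∈ (Icc 1 m).powersetCard p, weight I := by
  have hm : m + 2 ∉ Icc 1 (m + 1) := by simp
  have hIcc : Icc 1 (m + 2) = insert (m + 2) (Icc 1 (m + 1)) := by
    ext i
    simp only [mem_insert, mem_Icc]
    omega
  have hnotMem {n : ℕ} {J : Finset ℕ} (hJ : J ∈ (Icc 1 (m + 1)).powersetCard n) :
      m + 2 ∉ J := fun h => hm ((mem_powersetCard.1 hJ).1 h)
  rw [hIcc, powersetCard_succ_insert hm, sum_union, sum_image,
    sum_congr rfl fun J hJ => weight_insert (mem_powersetCard.1 hJ).1, sum_sub_distrib,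
    ← filter_notMem_powersetCard_Icc p m, sum_filter, mul_sum, mul_sum, add_sub_assoc]
  · simp only [ite_not, mul_ite, mul_zero]
  · intro A hA B hB hAB
    rw [← erase_insert (hnotMem hA), ← erase_insert (hnotMem hB), hAB]
  · refine disjoint_left.2 fun J hJ hJ' => ?_
    obtain ⟨K, -, rfl⟩ := mem_image.1 hJ'
    exact hnotMem hJ (mem_insert_self _ _)

/-- For all integers `k ≥ 2` and `0 ≤ p ≤ k`,
`F̃_p^k = F̃_p^{k−1} + x_k·F̃_{p−1}^{k−1} − q_{k−1}·x_k·F̃_{p−1}^{k−2}`. -/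
theorem statement1 (k p : ℤ) (hk : 2 ≤ k) (hp : 0 ≤ p) (hpk : p ≤ k) :
    Ft p k = Ft p (k - 1) + xv k.toNat * Ft (p - 1) (k - 1)
      - qv (k - 1).toNat * xv k.toNat * Ft (p - 1) (k - 2) := by
  obtain ⟨m, rfl⟩ : ∃ m : ℕ, k = (m + 2 : ℕ) := ⟨(k - 2).toNat, by omega⟩
  have h1 : ((m + 2 : ℕ) : ℤ) - 1 = (m + 1 : ℕ) := by omega
  have h2 : ((m + 2 : ℕ) : ℤ) - 2 = m := by omega
  rw [h1, h2, Int.toNat_natCast, Int.toNat_natCast]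
  obtain ⟨p, rfl⟩ := Int.eq_ofNat_of_zero_le hp
  cases p with
  | zero =>
    rw [Nat.cast_zero, Ft_zero, Ft_zero, Ft_of_neg (by omega), Ft_of_neg (by omega)]
    simp
  | succ p =>
    have h3 : ((p + 1 : ℕ) : ℤ) - 1 = p := by omega
    rw [h3, Ft_natCast, Ft_natCast, Ft_natCast, Ft_natCast, sum_weight_succ]
end
end

section
/- For all integers k ≥ 1 and all integers p with 0 ≤ p ≤ k, the following identity holds in the fraction field of ℤ[q_1, q_2, …, x_1, x_2, …]: F̄_p^k = (1 − x_1)·(1 − x_2)·⋯·(1 − x_k) · F̃_{k−p}^k((1 − x_1)^{−1}, …, (1 − x_k)^{−1}), where F̃_{k−p}^k((1 − x_1)^{−1}, …, (1 − x_k)^{−1}) denotes the result of substituting (1 − x_i)^{−1} for x_i (for i = 1, …, k) in F̃_{k−p}^k while leaving the variables q_i unchanged. -/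
open MvPolynomial Finset

noncomputable section

/-- The polynomial `F_p^k`, defined as `0` unless `0 ≤ p ≤ k`. -/
def Fp (p k : ℤ) : P :=
  if 0 ≤ p ∧ p ≤ k then
    ∑ I ∈ (Finset.Icc 1 k.toNat).powersetCard p.toNat,
      (∏ i ∈ I, (1 - xv i)) * ∏ i ∈ I.filter (fun i => i + 1 ∉ I), (1 - qv i)
  else 0

/-- The substitution `q_k ↦ 0`. -/
def setQ (k : ℕ) : P →ₐ[ℤ] P :=
  aeval (fun v => if v = Sum.inl k then 0 else X v)

/-- `F̄_p^k`, i.e. `F_p^k` with `q_k` set to `0`. -/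
def Fbar (p k : ℤ) : P := setQ k.toNat (Fp p k)

/-- The fraction field of `ℤ[q_1, q_2, …, x_1, x_2, …]`. -/
abbrev K : Type := FractionRing P

/-- The substitution `x_i ↦ (1 − x_i)⁻¹` for `i = 1, …, k`, leaving the `q_i` (and the
remaining `x_i`) unchanged, with values in the fraction field. -/
def substInv (k : ℤ) : P →ₐ[ℤ] K :=
  aeval fun v =>
    match v with
    | Sum.inl i => algebraMap P K (qv i)
    | Sum.inr i =>
        if 1 ≤ i ∧ i ≤ k.toNat then (algebraMap P K (1 - xv i))⁻¹
        else algebraMap P K (xv i)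

lemma setQ_xv (n i : ℕ) : setQ n (xv i) = xv i := by
  simp [setQ, xv]

lemma setQ_qv (n i : ℕ) : setQ n (qv i) = if i = n then 0 else qv i := by
  simp [setQ, qv]

lemma substInv_qv (k : ℤ) (i : ℕ) : substInv k (qv i) = algebraMap P K (qv i) := by
  simp [substInv, qv]

lemma substInv_xv (k : ℤ) {i : ℕ} (hi : i ∈ Icc 1 k.toNat) :
    substInv k (xv i) = (algebraMap P K (1 - xv i))⁻¹ := by
  rw [mem_Icc] at hi
  rw [substInv, xv, aeval_X]
  exact if_pos hi

lemma one_sub_xv_ne_zero (i : ℕ) : (1 - xv i : P) ≠ 0 := by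
  intro h
  have h' := congrArg (aeval (fun _ => (0 : ℤ))) h
  simp [xv] at h'

lemma algebraMap_one_sub_xv_ne_zero (i : ℕ) : algebraMap P K (1 - xv i) ≠ 0 :=
  (map_ne_zero_iff _ (IsFractionRing.injective P K)).2 (one_sub_xv_ne_zero i)

/-- Passing to the complement turns the last elements `i < n` of the runs of `I` into the first
elements `i + 1 > 1` of the runs of the complement. -/
lemma setQ_prod_one_sub_qv (n : ℕ) {I : Finset ℕ} (hI : I ⊆ Icc 1 n) :
    setQ n (∏ i ∈ I.filter (fun i => i + 1 ∉ I), (1 - qv i)) =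
      ∏ i ∈ ((Icc 1 n \ I).erase 1).filter (fun i => i - 1 ∉ Icc 1 n \ I),
        (1 - qv (i - 1)) := by
  have hterm : ∀ i, setQ n (1 - qv i) = if i ≠ n then 1 - qv i else 1 := by
    intro i
    rw [map_sub, map_one, setQ_qv]
    split_ifs <;> simp_all
  rw [map_prod, prod_congr rfl fun i _ => hterm i, ← prod_filter]
  have hI' : ∀ i ∈ I, 1 ≤ i ∧ i ≤ n := fun i hi => mem_Icc.1 (hI hi)
  refine prod_nbij' (· + 1) (· - 1) ?_ ?_ ?_ ?_ ?_
  · intro i hi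
    simp only [mem_filter, mem_erase, mem_sdiff, mem_Icc] at hi ⊢
    have := hI' i hi.1.1
    refine ⟨⟨by omega, ⟨by omega, by omega⟩, hi.1.2⟩, ?_⟩
    simp [hi.1.1]
  · intro j hj
    simp only [mem_filter, mem_erase, mem_sdiff, mem_Icc] at hj ⊢
    obtain ⟨⟨h1, ⟨h2, h3⟩, h4⟩, h5⟩ := hj
    have h6 : j - 1 ∈ I := by
      by_contra h
      exact h5 ⟨⟨by omega, by omega⟩, h⟩
    refine ⟨⟨h6, ?_⟩, by omega⟩
    rwa [Nat.sub_add_cancel h2]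
  · intro i _
    simp
  · intro j hj
    simp only [mem_filter, mem_erase, mem_sdiff, mem_Icc] at hj
    exact Nat.sub_add_cancel hj.1.2.1.1
  · intro i _
    simp

/-- The summand of `F̄_p^k` at `I` matches the summand of `F̃_{k-p}^k` at the complement of `I`. -/
lemma algebraMap_setQ_term (k : ℤ) {I : Finset ℕ} (hI : I ⊆ Icc 1 k.toNat) :
    algebraMap P K (setQ k.toNat
        ((∏ i ∈ I, (1 - xv i)) * ∏ i ∈ I.filter (fun i => i + 1 ∉ I), (1 - qv i))) =
      (∏ i ∈ Icc 1 k.toNat, algebraMap P K (1 - xv i)) *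
        substInv k ((∏ i ∈ Icc 1 k.toNat \ I, xv i) *
          ∏ i ∈ ((Icc 1 k.toNat \ I).erase 1).filter (fun i => i - 1 ∉ Icc 1 k.toNat \ I),
            (1 - qv (i - 1))) := by
  have hq : ∀ s : Finset ℕ, substInv k (∏ i ∈ s, (1 - qv (i - 1))) =
      algebraMap P K (∏ i ∈ s, (1 - qv (i - 1))) := by
    intro s
    simp only [map_prod, map_sub, map_one, substInv_qv]
  have hx : setQ k.toNat (∏ i ∈ I, (1 - xv i)) = ∏ i ∈ I, (1 - xv i) := by
    simp only [map_prod, map_sub, map_one, setQ_xv]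
  rw [map_mul, setQ_prod_one_sub_qv _ hI, hx, map_mul, map_mul, hq, ← mul_assoc]
  congr 1
  rw [map_prod, map_prod, prod_congr rfl fun i hi => substInv_xv k (mem_sdiff.1 hi).1,
    prod_inv_distrib, ← prod_sdiff hI, mul_comm (∏ i ∈ _ \ _, _), mul_inv_cancel_right₀]
  exact prod_ne_zero_iff.2 fun i _ => algebraMap_one_sub_xv_ne_zero i

/-- For all integers `k ≥ 1` and `0 ≤ p ≤ k`, in the fraction field one has
`F̄_p^k = (1 − x_1)⋯(1 − x_k) · F̃_{k−p}^k((1 − x_1)⁻¹, …, (1 − x_k)⁻¹)`. -/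
theorem statement3 (k p : ℤ) (hk : 1 ≤ k) (hp : 0 ≤ p) (hpk : p ≤ k) :
    algebraMap P K (Fbar p k) =
      (∏ i ∈ Finset.Icc 1 k.toNat, algebraMap P K (1 - xv i)) * substInv k (Ft (k - p) k) := by
  have hcard : (Icc 1 k.toNat).card = k.toNat := by simp
  rw [Fbar, Fp, Ft, if_pos ⟨hp, hpk⟩, if_pos ⟨by omega, by omega⟩, map_sum, map_sum, map_sum,
    mul_sum]
  refine sum_nbij' (Icc 1 k.toNat \ ·) (Icc 1 k.toNat \ ·) ?_ ?_ ?_ ?_ ?_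
  · intro I hI
    rw [mem_powersetCard] at hI ⊢
    refine ⟨sdiff_subset, ?_⟩
    rw [card_sdiff_of_subset hI.1, hI.2, hcard]
    omega
  · intro I hI
    rw [mem_powersetCard] at hI ⊢
    refine ⟨sdiff_subset, ?_⟩
    rw [card_sdiff_of_subset hI.1, hI.2, hcard]
    omega
  · intro I hI
    exact _root_.sdiff_sdiff_eq_self (mem_powersetCard.1 hI).1
  · intro I hI
    exact _root_.sdiff_sdiff_eq_self (mem_powersetCard.1 hI).1
  · intro I hI
    exact algebraMap_setQ_term k (mem_powersetCard.1 hI).1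
end
end

section
/- For every integer k ≥ 1, the identity G_1^k = 1 − (1 − x_1)·(1 − x_2)·⋯·(1 − x_k)·(1 − q_k) holds in ℤ[q_1, q_2, …, x_1, x_2, …]. -/
open MvPolynomial Finset

noncomputable section

/-- The polynomial `Ê_p^k = Σ_{i=0}^p (−1)^i C(k−i, p−i) F_i^k`, defined as `0` unless
`0 ≤ p ≤ k`. -/
def Ehat (p k : ℤ) : P :=
  if 0 ≤ p ∧ p ≤ k then
    ∑ i ∈ Finset.range (p.toNat + 1),
      (-1 : P) ^ i * (Nat.choose (k.toNat - i) (p.toNat - i) : P) * Fp (i : ℤ) k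
  else 0

/-- `Ē_p^k`, i.e. `Ê_p^k` with `q_k` set to `0`. -/
def Ebar (p k : ℤ) : P := setQ k.toNat (Ehat p k)

/-- The polynomial `G_p^k`: `G_0^k = 1`, and for `p ≥ 1`,
`G_p^k = Σ_{i=p}^k (−1)^{i−p} C(i−1, p−1) Ê_i^k`; it is `0` unless `0 ≤ p ≤ k`. -/
def Gq (p k : ℤ) : P :=
  if 0 ≤ p ∧ p ≤ k then
    if p = 0 then 1
    else
      ∑ i ∈ Finset.Icc p k,
        (-1 : P) ^ (i - p).toNat * (Nat.choose (i - 1).toNat (p - 1).toNat : P) * Ehat i k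
  else 0

/-- `Ḡ_p^k`, i.e. `G_p^k` with `q_k` set to `0`. -/
def Gbar (p k : ℤ) : P := setQ k.toNat (Gq p k)

theorem alternating_sum_range_choose_cast {R : Type*} [CommRing R] (n : ℕ) :
    ∑ m ∈ range (n + 1), (-1 : R) ^ m * (n.choose m : R) = if n = 0 then 1 else 0 := by
  have h := congrArg (Int.cast : ℤ → R) (Int.alternating_sum_range_choose (n := n))
  push_cast at h
  exact h

theorem Fp_zero {n : ℕ} : Fp 0 (n : ℤ) = 1 := by
  simp [Fp]

theorem Fp_self {n : ℕ} (hn : 1 ≤ n) :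
    Fp n n = (∏ i ∈ Icc 1 n, (1 - xv i)) * (1 - qv n) := by
  have hcard : (Icc 1 n).powersetCard n = {Icc 1 n} := by
    simpa using powersetCard_self (Icc 1 n)
  have hfilter : (Icc 1 n).filter (fun i => i + 1 ∉ Icc 1 n) = {n} := by
    ext i
    simp only [mem_filter, mem_Icc, mem_singleton]
    omega
  rw [Fp, if_pos ⟨by positivity, le_rfl⟩, Int.toNat_natCast, hcard, sum_singleton, hfilter,
    prod_singleton]

theorem Ehat_natCast {p n : ℕ} (h : p ≤ n) :
    Ehat p n = ∑ j ∈ range (p + 1), (-1 : P) ^ j * ((n - j).choose (p - j) : P) * Fp j n := by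
  rw [Ehat, if_pos ⟨by positivity, by exact_mod_cast h⟩, Int.toNat_natCast, Int.toNat_natCast]

theorem Ehat_zero {n : ℕ} : Ehat 0 (n : ℤ) = 1 := by
  simp [Ehat, Fp_zero]

theorem alternating_sum_range_Ehat (n : ℕ) :
    ∑ i ∈ range (n + 1), (-1 : P) ^ i * Ehat i n = Fp n n := by
  calc
    _ = ∑ i ∈ range (n + 1), ∑ j ∈ range (i + 1),
          (-1 : P) ^ i * ((-1 : P) ^ j * ((n - j).choose (i - j) : P) * Fp j n) := by
      refine sum_congr rfl fun i hi => ?_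
      rw [Ehat_natCast (Nat.lt_succ_iff.mp (mem_range.mp hi)), mul_sum]
    _ = ∑ j ∈ range (n + 1), ∑ i ∈ Ico j (n + 1),
          (-1 : P) ^ i * ((-1 : P) ^ j * ((n - j).choose (i - j) : P) * Fp j n) := by
      refine sum_comm' fun i j => ?_
      simp only [mem_range, mem_Ico]
      omega
    _ = ∑ j ∈ range (n + 1), if j = n then Fp j n else 0 := by
      refine sum_congr rfl fun j hj => ?_
      have hjn : j ≤ n := Nat.lt_succ_iff.mp (mem_range.mp hj)
      have hterm (m : ℕ) : (-1 : P) ^ (j + m) *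
          ((-1 : P) ^ j * ((n - j).choose (j + m - j) : P) * Fp j n) =
          (-1 : P) ^ m * ((n - j).choose m : P) * Fp j n := by
        have hsq : (-1 : P) ^ j * (-1 : P) ^ j = 1 := by rw [← mul_pow]; simp
        rw [Nat.add_sub_cancel_left, pow_add]
        linear_combination (-1 : P) ^ m * ((n - j).choose m : P) * Fp j n * hsq
      rw [sum_Ico_eq_sum_range, sum_congr rfl fun m _ => hterm m, ← sum_mul,
        Nat.succ_sub hjn, alternating_sum_range_choose_cast, ite_mul, one_mul, zero_mul]
      exact if_congr (by omega) rfl rfl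
    _ = Fp n n := by simp

theorem Gq_one_natCast {n : ℕ} (hn : 1 ≤ n) :
    Gq 1 n = ∑ i ∈ range n, (-1 : P) ^ i * Ehat (i + 1 : ℕ) n := by
  rw [Gq, if_pos ⟨zero_le_one, by exact_mod_cast hn⟩, if_neg one_ne_zero]
  symm
  refine sum_bij (fun i _ => ((i + 1 : ℕ) : ℤ)) ?_ ?_ ?_ ?_
  · intro i hi
    rw [mem_range] at hi
    rw [mem_Icc]
    omega
  · intro i _ j _ h
    omega
  · intro b hb
    rw [mem_Icc] at hb
    exact ⟨(b - 1).toNat, by rw [mem_range]; omega, by omega⟩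
  · intro i _
    simp

/-- For every integer `k ≥ 1`,
`G_1^k = 1 − (1 − x_1)·(1 − x_2)·⋯·(1 − x_k)·(1 − q_k)`. -/
theorem statement13 (k : ℤ) (hk : 1 ≤ k) :
    Gq 1 k = 1 - (∏ i ∈ Finset.Icc 1 k.toNat, (1 - xv i)) * (1 - qv k.toNat) := by
  lift k to ℕ using by omega
  have hn : 1 ≤ k := by exact_mod_cast hk
  have h := alternating_sum_range_Ehat k
  rw [sum_range_succ', Nat.cast_zero, Ehat_zero, Fp_self hn] at h
  simp only [pow_succ, mul_neg_one, neg_mul, sum_neg_distrib, pow_zero, one_mul] at h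
  rw [Gq_one_natCast hn, Int.toNat_natCast]
  linear_combination -h
end
end
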